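/- Let p ≡ 1 (mod 4) be prime, set t = (p−1)/4, and let T be a generator of the group of multiplicative characters of F_p^× with values in ℂ_p. Then for every x ∈ F_p^×, the value 3p² · binom(T^{3t}, T^t) · ₂F₁(T^{3t}, T^t; T^{2t} | x)_p is congruent to 0 modulo p, i.e. it lies in p·O where O is the valuation ring of ℂ_p. -/

import Mathlib

/-- Greene's normalized Jacobi sum `binom(A,B) = B(-1)/q · ∑ₓ A(x) B̄(1-x)`. -/
noncomputable def jacB {F K : Type*} [Field F] [Fintype F] [Field K]
    (A B : MulChar F K) : K :=
  B (-1) / (Fintype.card F : K) * ∑ x : F, A x * B⁻¹ (1 - x)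

/-- Greene's finite field hypergeometric function `₂F₁(A, B; C | x)`. -/
noncomputable def greene2F1 {F K : Type*} [Field F] [Fintype F] [Field K]
    (A B C : MulChar F K) (x : F) : K :=
  (Fintype.card F : K) / ((Fintype.card F : K) - 1) *
    ∑ᶠ χ : MulChar F K, jacB (A * χ) χ * jacB (B * χ) (C * χ) * χ x

/-- The rising factorial (Pochhammer symbol) `(a)ₙ = a(a+1)⋯(a+n-1)` of a rational number. -/
def risingFac (a : ℚ) (n : ℕ) : ℚ :=
  ∏ i ∈ Finset.range n, (a + i)

lemma mul_inv_eq_one_iff_eq_div {F : Type*} [Field F] {a b x : F} (hb : b ≠ 0)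
    (hb' : 1 - b ≠ 0) (hx : x ≠ 0) :
    a * b * x * ((1 - a) * (1 - b))⁻¹ = 1 ↔
      1 - b + b * x ≠ 0 ∧ a = (1 - b) * (1 - b + b * x)⁻¹ := by
  have key : a * b * x - (1 - a) * (1 - b) = a * (1 - b + b * x) - (1 - b) := by ring
  constructor
  · intro h
    have h0 : (1 - a) * (1 - b) ≠ 0 := by
      intro h0
      simp [h0] at h
    have h1 : a * (1 - b + b * x) = 1 - b := by
      rw [mul_inv_eq_one₀ h0] at h
      linear_combination h - key
    have h2 : 1 - b + b * x ≠ 0 := by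
      intro h2
      rw [h2, mul_zero] at h1
      exact hb' h1.symm
    exact ⟨h2, (eq_mul_inv_iff_mul_eq₀ h2).2 h1⟩
  · rintro ⟨h2, h⟩
    have h1 := (eq_mul_inv_iff_mul_eq₀ h2).1 h
    have ha : 1 - a ≠ 0 := by
      intro ha
      have : a = 1 := by linear_combination -ha
      subst this
      exact mul_ne_zero hb hx (by linear_combination h1)
    rw [mul_inv_eq_one₀ (mul_ne_zero ha hb')]
    linear_combination key + h1

section CharacterSums

variable {F K : Type*} [Field F] [Fintype F] [Field K]

lemma MulChar.sum_apply_eq_ite [DecidableEq F] [Fintype (MulChar F K)]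
    [HasEnoughRootsOfUnity K (Monoid.exponent Fˣ)] (a : F) :
    ∑ χ : MulChar F K, χ a = if a = 1 then (Fintype.card F : K) - 1 else 0 := by
  split_ifs with ha
  · have hcard : Fintype.card (MulChar F K) = Fintype.card F - 1 := by
      rw [← Nat.card_eq_fintype_card, MulChar.card_eq_card_units_of_hasEnoughRootsOfUnity,
        Nat.card_eq_fintype_card, Fintype.card_units]
    simp [ha, hcard, Nat.cast_sub Fintype.card_pos]
  · obtain ⟨χ, hχ⟩ := MulChar.exists_apply_ne_one_of_hasEnoughRootsOfUnity F K ha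
    refine eq_zero_of_mul_eq_self_left hχ ?_
    simp only [Finset.mul_sum, ← MulChar.mul_apply]
    exact Fintype.sum_bijective _ (Group.mulLeft_bijective χ) _ _ fun _ ↦ rfl

lemma jacB_mul_jacB (A B C χ : MulChar F K) (x : F) :
    jacB (A * χ) χ * jacB (B * χ) (C * χ) * χ x =
      C (-1) / (Fintype.card F : K) ^ 2 * ∑ b, ∑ a, A a * B b * C⁻¹ (1 - b) *
        χ (a * b * x * ((1 - a) * (1 - b))⁻¹) := by
  have hχ : χ (-1) * χ (-1) = 1 := by rw [← map_mul]; simp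
  have hsum : (∑ b, ∑ a, A a * B b * C⁻¹ (1 - b) * χ (a * b * x * ((1 - a) * (1 - b))⁻¹)) =
      (∑ a, (A * χ) a * χ⁻¹ (1 - a)) * (∑ b, (B * χ) b * (C * χ)⁻¹ (1 - b)) * χ x := by
    rw [Finset.sum_mul_sum, Finset.sum_comm, Finset.sum_mul]
    refine Finset.sum_congr rfl fun a _ ↦ ?_
    rw [Finset.sum_mul]
    refine Finset.sum_congr rfl fun b _ ↦ ?_
    simp only [mul_inv, MulChar.mul_apply, MulChar.inv_apply', map_mul]
    ring
  rw [hsum, jacB, jacB, MulChar.mul_apply C χ (-1)]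
  linear_combination (C (-1) / (Fintype.card F : K) ^ 2 *
    ((∑ a, (A * χ) a * χ⁻¹ (1 - a)) * (∑ b, (B * χ) b * (C * χ)⁻¹ (1 - b)) * χ x)) * hχ

/-- The integral representation of Greene's `₂F₁`. -/
theorem greene2F1_eq_sum [CharZero K] [HasEnoughRootsOfUnity K (Monoid.exponent Fˣ)]
    (A B C : MulChar F K) {x : F} (hx : x ≠ 0) :
    greene2F1 A B C x = C (-1) / (Fintype.card F : K) *
      ∑ b, B b * (A * C⁻¹) (1 - b) * A⁻¹ (1 - b + b * x) := by
  classical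
  have := Fintype.ofFinite (MulChar F K)
  have hq : (Fintype.card F : K) ≠ 0 := Nat.cast_ne_zero.2 Fintype.card_ne_zero
  have hq' : (Fintype.card F : K) - 1 ≠ 0 :=
    sub_ne_zero.2 (by exact_mod_cast Fintype.one_lt_card.ne')
  have hinner (b : F) : ∑ a, A a * B b * C⁻¹ (1 - b) *
        ∑ χ : MulChar F K, χ (a * b * x * ((1 - a) * (1 - b))⁻¹) =
      ((Fintype.card F : K) - 1) * (B b * (A * C⁻¹) (1 - b) * A⁻¹ (1 - b + b * x)) := by
    simp only [MulChar.sum_apply_eq_ite]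
    by_cases hb : b = 0
    · simp [hb, MulChar.map_zero]
    by_cases hb' : 1 - b = 0
    · simp [hb', MulChar.map_zero]
    simp only [mul_inv_eq_one_iff_eq_div hb hb' hx]
    by_cases h : 1 - b + b * x = 0
    · simp [h, MulChar.map_zero]
    · simp only [h, ne_eq, not_false_eq_true, true_and, mul_ite, mul_zero, Finset.sum_ite_eq',
        Finset.mem_univ, if_true, MulChar.mul_apply, MulChar.inv_apply', map_mul]
      ring
  rw [greene2F1, finsum_eq_sum_of_fintype]
  simp only [jacB_mul_jacB]
  rw [← Finset.mul_sum, Finset.sum_comm]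
  simp only [Finset.sum_comm (s := (Finset.univ : Finset (MulChar F K))), ← Finset.mul_sum, hinner]
  field_simp
  simp only [mul_comm x]

lemma FiniteField.sum_eval_eq_zero_of_natDegree_lt {P : Polynomial F}
    (hP : P.natDegree < Fintype.card F - 1) : ∑ x : F, P.eval x = 0 := by
  simp only [Polynomial.eval_eq_sum_range]
  rw [Finset.sum_comm]
  refine Finset.sum_eq_zero fun i hi ↦ ?_
  rw [← Finset.mul_sum, FiniteField.sum_pow_lt_card_sub_one, mul_zero]
  grind

end CharacterSums

section Teichmuller

variable (p : ℕ) [Fact p.Prime]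

open IsLocalRing in
lemma PadicInt.exists_pow_eq_one_toZMod_eq (g : (ZMod p)ˣ) :
    ∃ ζ : ℤ_[p], ζ ^ (p - 1) = 1 ∧ PadicInt.toZMod ζ = g := by
  have hp := (Fact.out : p.Prime).two_le
  have hsurj : Function.Surjective (PadicInt.toZMod : ℤ_[p] →+* ZMod p) :=
    ZMod.ringHom_surjective _
  obtain ⟨a, ha⟩ := hsurj g
  have hmem (z : ℤ_[p]) : z ∈ maximalIdeal ℤ_[p] ↔ PadicInt.toZMod z = 0 := by
    rw [← PadicInt.ker_toZMod, RingHom.mem_ker]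
  obtain ⟨ζ, hζ, hζa⟩ := HenselianRing.is_henselian (I := maximalIdeal ℤ_[p])
    (Polynomial.X ^ (p - 1) - Polynomial.C (1 : ℤ_[p]))
    (Polynomial.monic_X_pow_sub_C _ (by omega)) a
    (by simp [hmem, ha, ZMod.pow_card_sub_one_eq_one g.ne_zero])
    (by
      refine IsUnit.map _ ?_
      rw [← notMem_maximalIdeal, hmem]
      simp [Polynomial.derivative_X_pow, ha, Nat.cast_sub (by omega : 1 ≤ p)])
  refine ⟨ζ, by simpa [sub_eq_zero] using hζ, ?_⟩
  rwa [hmem, map_sub, ha, sub_eq_zero] at hζa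

/-- Every character of `𝔽_p` valued in an extension of `ℤ_p` is a power of the Teichmüller
character. -/
theorem exists_teichmuller_mulChar :
    ∃ ω : MulChar (ZMod p) ℤ_[p], (∀ y, PadicInt.toZMod (ω y) = y) ∧
      ∀ {K : Type*} [Field K] (ι : ℤ_[p] →+* K), Function.Injective ι →
        ∀ χ : MulChar (ZMod p) K, ∃ m : ℕ, χ = (ω.ringHomComp ι) ^ m := by
  obtain ⟨g, hg⟩ := IsCyclic.exists_generator (α := (ZMod p)ˣ)
  obtain ⟨ζ, hζ, hζg⟩ := PadicInt.exists_pow_eq_one_toZMod_eq p g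
  have hp := (Fact.out : p.Prime).two_le
  have hcard : Fintype.card (ZMod p)ˣ = p - 1 := ZMod.card_units p
  have horder : orderOf g = p - 1 := by
    rw [orderOf_eq_card_of_forall_mem_zpowers hg, Nat.card_eq_fintype_card, hcard]
  have hprim : IsPrimitiveRoot ζ (p - 1) := by
    refine ⟨hζ, fun l hl ↦ ?_⟩
    rw [← horder, orderOf_dvd_iff_pow_eq_one, Units.ext_iff]
    simpa [hζg] using congrArg PadicInt.toZMod hl
  have hmem : (hprim.isUnit (by omega)).unit ∈ rootsOfUnity (Fintype.card (ZMod p)ˣ) ℤ_[p] := by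
    rw [mem_rootsOfUnity, Units.ext_iff, hcard]
    simpa using hζ
  have hspec : MulChar.ofRootOfUnity hmem hg g = ζ := MulChar.ofRootOfUnity_spec hmem hg
  refine ⟨MulChar.ofRootOfUnity hmem hg, fun y ↦ ?_, fun {K} _ ι hι χ ↦ ?_⟩
  · rcases eq_or_ne y 0 with rfl | hy
    · rw [MulChar.map_zero, map_zero]
    · obtain ⟨n, hn⟩ := mem_powers_iff_mem_zpowers.2 (hg (Units.mk0 y hy))
      have : y = (g : ZMod p) ^ n := by simpa using (congrArg Units.val hn).symm
      rw [this, map_pow, map_pow, hspec, hζg]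
  · have : NeZero (p - 1) := ⟨by omega⟩
    obtain ⟨m, -, hm⟩ := (hprim.map_of_injective hι).eq_pow_of_pow_eq_one (ξ := χ g) (by
      rw [← map_pow, ZMod.pow_card_sub_one_eq_one g.ne_zero, map_one])
    refine ⟨m, (MulChar.eq_iff hg _ _).2 ?_⟩
    rw [MulChar.pow_apply_coe, MulChar.ringHomComp_apply, hspec, hm]

end Teichmuller

lemma PadicInt.norm_le_inv_of_toZMod_eq_zero {p : ℕ} [Fact p.Prime] {z : ℤ_[p]}
    (hz : PadicInt.toZMod z = 0) : ‖z‖ ≤ (p : ℝ)⁻¹ := by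
  rw [← RingHom.mem_ker, PadicInt.ker_toZMod, PadicInt.maximalIdeal_eq_span_p,
    ← pow_one (p : ℤ_[p]), ← PadicInt.norm_le_pow_iff_mem_span_pow] at hz
  simpa using hz

lemma ZMod.pow_mul_eq_pow_of_mod_four_eq_one {p t n : ℕ} [Fact p.Prime] (hp : p = 4 * t + 1)
    (ht : t ≠ 0) (hn : n % 4 = 1) (y : ZMod p) : y ^ (n * t) = y ^ t := by
  rcases eq_or_ne y 0 with rfl | hy
  · rw [zero_pow ht, zero_pow (mul_ne_zero (by omega) ht)]
  · have h := ZMod.pow_card_sub_one_eq_one hy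
    have hn' : n * t = (p - 1) * (n / 4) + t := by
      obtain ⟨l, rfl⟩ : ∃ l, n = 4 * l + 1 := ⟨n / 4, by omega⟩
      rw [hp, show (4 * l + 1) / 4 = l by omega, Nat.add_sub_cancel]
      ring
    rw [hn', pow_add, pow_mul, h, one_pow, one_mul]

lemma sum_pow_mul_pow_eq_zero {p t : ℕ} [Fact p.Prime] (hp : p = 4 * t + 1) (ht : t ≠ 0) :
    ∑ a : ZMod p, a ^ t * (1 - a) ^ t = 0 := by
  have h := FiniteField.sum_eval_eq_zero_of_natDegree_lt
    (P := (Polynomial.X ^ t * (1 - Polynomial.X) ^ t : Polynomial (ZMod p))) (by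
      rw [ZMod.card]
      have : (Polynomial.X ^ t * (1 - Polynomial.X) ^ t : Polynomial (ZMod p)).natDegree
          ≤ t + t := by compute_degree
      omega)
  simpa using h

lemma sum_pow_mul_pow_mul_pow_eq_zero {p t : ℕ} [Fact p.Prime] (hp : p = 4 * t + 1) (ht : t ≠ 0)
    (x : ZMod p) : ∑ b : ZMod p, b ^ t * (1 - b) ^ t * (1 - b + b * x) ^ t = 0 := by
  have h := FiniteField.sum_eval_eq_zero_of_natDegree_lt
    (P := (Polynomial.X ^ t * (1 - Polynomial.X) ^ t *
      (1 - Polynomial.X + Polynomial.X * Polynomial.C x) ^ t : Polynomial (ZMod p))) (by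
      rw [ZMod.card]
      have : (Polynomial.X ^ t * (1 - Polynomial.X) ^ t *
          (1 - Polynomial.X + Polynomial.X * Polynomial.C x) ^ t : Polynomial (ZMod p)).natDegree
          ≤ t + t + t := by compute_degree
      omega)
  simpa only [Polynomial.eval_mul, Polynomial.eval_pow, Polynomial.eval_add, Polynomial.eval_sub,
    Polynomial.eval_X, Polynomial.eval_C, Polynomial.eval_one] using h

/-- Lemma 7.2: for `p ≡ 1 (mod 4)` prime, `t = (p-1)/4`, and `T` a generator of the group of
multiplicative characters of `F_p^×` with values in `ℂ_p` (formalized as an algebraically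
closed complete nontrivially normed field extension `K` of `ℚ_p`): for every `x ∈ F_p^×`,
`3p² · binom(T^{3t}, T^t) · ₂F₁(T^{3t}, T^t; T^{2t} | x)ₚ ≡ 0 (mod p)`, i.e. this value
lies in `p·O` where `O` is the valuation ring (its norm is at most `1/p`). -/
theorem greene_2F1_term_congruent_zero
    (p : ℕ) [Fact p.Prime] (hp4 : p % 4 = 1)
    (K : Type*) [NontriviallyNormedField K] [IsAlgClosed K]
    [NormedAlgebra ℚ_[p] K] [CompleteSpace K]
    (t : ℕ) (ht : t = (p - 1) / 4)
    (T : MulChar (ZMod p) K) (hT : ∀ χ : MulChar (ZMod p) K, χ ∈ Subgroup.zpowers T)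
    (x : ZMod p) (hx : x ≠ 0) :
    ‖3 * (p : K) ^ 2 * jacB (T ^ (3 * t)) (T ^ t) *
        greene2F1 (T ^ (3 * t)) (T ^ t) (T ^ (2 * t)) x‖ ≤ (p : ℝ)⁻¹ := by
  have hp2 := (Fact.out : p.Prime).two_le
  have hpt : p = 4 * t + 1 := by omega
  have ht0 : t ≠ 0 := by omega
  have hK : CharZero K := charZero_of_injective_algebraMap (algebraMap ℚ_[p] K).injective
  have hpK : (p : K) ≠ 0 := Nat.cast_ne_zero.2 (by omega)
  have : NeZero ((Monoid.exponent (ZMod p)ˣ : ℕ) : K) :=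
    ⟨Nat.cast_ne_zero.2 Monoid.exponent_ne_zero_of_finite⟩
  let ι : ℤ_[p] →+* K := (algebraMap ℚ_[p] K).comp PadicInt.Coe.ringHom
  have hι : Function.Injective ι :=
    (algebraMap ℚ_[p] K).injective.comp Subtype.val_injective
  have hnorm (z : ℤ_[p]) : ‖ι z‖ = ‖z‖ := norm_algebraMap' K (z : ℚ_[p])
  obtain ⟨ω, hω, hpow⟩ := exists_teichmuller_mulChar p
  obtain ⟨m, hm⟩ := hpow ι hι T
  have hcard : Fintype.card (ZMod p)ˣ = 4 * t := by rw [ZMod.card_units]; omega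
  have hT4 : T ^ (4 * t) = 1 := by rw [← hcard]; exact T.pow_card_eq_one
  have hodd : m % 2 = 1 := by
    by_contra hm2
    obtain ⟨l, rfl⟩ : 2 ∣ m := by omega
    have hT2 : T ^ (2 * t) = 1 := by
      have hω4 : (ω.ringHomComp ι) ^ (4 * t) = 1 := by
        rw [← hcard]; exact MulChar.pow_card_eq_one _
      rw [hm, ← pow_mul, show 2 * l * (2 * t) = 4 * t * l by ring, pow_mul, hω4, one_pow]
    obtain ⟨k, hk⟩ := Subgroup.mem_zpowers_iff.1 (hT (ω.ringHomComp ι))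
    have hω2 : (ω.ringHomComp ι) ^ (2 * t) = 1 := by
      rw [← hk, ← zpow_natCast, zpow_comm, zpow_natCast, hT2, one_zpow]
    have hdvd := (FiniteField.forall_pow_eq_one_iff (ZMod p) (2 * t)).1 fun y ↦ by
      have hy : ι (ω y ^ (2 * t)) = ι 1 := by
        rw [map_pow, map_one, ← MulChar.ringHomComp_apply, ← MulChar.pow_apply_coe, hω2,
          MulChar.one_apply_coe]
      rw [Units.ext_iff]
      simpa [hω] using congrArg PadicInt.toZMod (hι hy)
    rw [ZMod.card] at hdvd
    have := Nat.le_of_dvd (by omega) hdvd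
    omega
  set ψ : MulChar (ZMod p) ℤ_[p] := ω ^ (m * t) with hψ
  have hTt : T ^ t = ψ.ringHomComp ι := by
    rw [hm, hψ, ← pow_mul, MulChar.ringHomComp_pow]
  have hmod (y : ZMod p) : PadicInt.toZMod (ψ y) = y ^ (m * t) := by
    rw [hψ, MulChar.pow_apply' _ (mul_ne_zero (by omega) ht0), map_pow, hω]
  have hTinv : (T ^ t)⁻¹ = T ^ (3 * t) := by
    rw [inv_eq_iff_mul_eq_one, ← pow_add, ← hT4]; congr 1; ring
  have hTinv' : (T ^ (3 * t))⁻¹ = T ^ t := by rw [← hTinv, inv_inv]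
  have hTC : T ^ (3 * t) * (T ^ (2 * t))⁻¹ = T ^ t := by
    rw [mul_inv_eq_iff_eq_mul, ← pow_add]; congr 1; ring
  have hT3 (y : ZMod p) : (T ^ (3 * t)) y = ι (ψ y ^ 3) := by
    rw [mul_comm, pow_mul, MulChar.pow_apply' _ three_ne_zero, hTt, MulChar.ringHomComp_apply,
      map_pow]
  have hT1 (y : ZMod p) : (T ^ t) y = ι (ψ y) := by rw [hTt, MulChar.ringHomComp_apply]
  have hT2 : (T ^ (2 * t)) (-1) = 1 := by
    rw [mul_comm, pow_mul, MulChar.pow_apply' _ two_ne_zero, sq, ← map_mul]; simp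
  have hval : 3 * (p : K) ^ 2 * jacB (T ^ (3 * t)) (T ^ t) *
        greene2F1 (T ^ (3 * t)) (T ^ t) (T ^ (2 * t)) x =
      ι (3 * ψ (-1) * (∑ a, ψ a ^ 3 * ψ (1 - a) ^ 3) *
        ∑ b, ψ b * ψ (1 - b) * ψ (1 - b + b * x)) := by
    rw [greene2F1_eq_sum _ _ _ hx, jacB, hTinv, hTinv', hTC, hT2, ZMod.card]
    simp only [hT1, hT3, map_mul, map_sum]
    field_simp
    simp only [mul_comm x, map_ofNat]
    ring
  rw [hval, hnorm]
  apply PadicInt.norm_le_inv_of_toZMod_eq_zero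
  simp only [map_mul, map_sum, map_pow, hmod]
  obtain h | h : m % 4 = 1 ∨ m % 4 = 3 := by omega
  · simp only [ZMod.pow_mul_eq_pow_of_mod_four_eq_one hpt ht0 h,
      sum_pow_mul_pow_mul_pow_eq_zero hpt ht0, mul_zero]
  · have h3 (y : ZMod p) : (y ^ (m * t)) ^ 3 = y ^ t := by
      rw [← pow_mul, show m * t * 3 = (3 * m) * t by ring,
        ZMod.pow_mul_eq_pow_of_mod_four_eq_one hpt ht0 (by omega)]
    simp only [h3, sum_pow_mul_pow_eq_zero hpt ht0, mul_zero, zero_mul]
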